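/- arXiv:1702.08708 — 2 statements merged into one kernel-verified Lean document; each statement's English description precedes it below -/
import Mathlib

section
/- For every T with 0 < T < 1/3, the function k ↦ c_ww(k;T) = sqrt((1 + T·k²)·tanh k / k) possesses a unique minimum over the interval (0,∞): there exists a unique k* > 0 such that c_ww(k*;T) ≤ c_ww(k;T) for all k > 0, and moreover c_ww(k*;T) < 1. -/
open Real Filter Set

/-- The water-wave phase speed with surface tension coefficient `T`:
`c_ww(k;T) = sqrt((1 + T k²) tanh k / k)` for `k ≠ 0`, extended by `c_ww(0;T) = 1`. -/
noncomputable def cwwT (T k : ℝ) : ℝ :=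
  if k = 0 then 1 else Real.sqrt ((1 + T * k ^ 2) * Real.tanh k / k)

theorem pos_of_hasDerivAt_pos {f f' : ℝ → ℝ} (hf : ∀ x, HasDerivAt f (f' x) x)
    (h0 : f 0 = 0) (hpos : ∀ x, 0 < x → 0 < f' x) {x : ℝ} (hx : 0 < x) : 0 < f x := by
  have hmono : StrictMonoOn f (Ici 0) := by
    refine strictMonoOn_of_deriv_pos (convex_Ici 0)
      (fun y _ => (hf y).continuousAt.continuousWithinAt) fun y hy => ?_
    rw [interior_Ici] at hy
    rw [(hf y).deriv]
    exact hpos y hy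
  simpa [h0] using hmono self_mem_Ici hx.le hx

theorem two_mul_sq_mul_cosh_lt {k : ℝ} (hk : 0 < k) :
    2 * k ^ 2 * cosh k < sinh k ^ 2 * cosh k + k * sinh k := by
  have hder (x : ℝ) : HasDerivAt (fun x => 3 * sinh x ^ 3 + 3 * sinh x - 3 * (x * cosh x)
      - 2 * (x ^ 2 * sinh x))
      (9 * sinh x ^ 2 * cosh x - 7 * x * sinh x - 2 * x ^ 2 * cosh x) x := by
    refine HasDerivAt.congr_deriv (((((hasDerivAt_sinh x).pow 3).const_mul 3).add ((hasDerivAt_sinh x).const_mul 3)).sub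
      (((hasDerivAt_id' x).mul (hasDerivAt_cosh x)).const_mul 3) |>.sub
      ((((hasDerivAt_id' x).pow 2).mul (hasDerivAt_sinh x)).const_mul 2)) ?_
    simp only [Pi.pow_apply]
    push_cast
    ring
  have hder_pos (x : ℝ) (hx : 0 < x) :
      0 < 3 * sinh x ^ 3 + 3 * sinh x - 3 * (x * cosh x) - 2 * (x ^ 2 * sinh x) := by
    refine pos_of_hasDerivAt_pos hder (by simp) (fun y hy => ?_) hx
    have hs : y < sinh y := self_lt_sinh_iff.2 hy
    have hs0 : 0 < sinh y := hy.trans hs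
    have hc : 1 < cosh y := one_lt_cosh.2 hy.ne'
    have h1 : y * sinh y < sinh y ^ 2 * cosh y := by
      calc y * sinh y < sinh y * sinh y := by gcongr
        _ = sinh y ^ 2 * 1 := by ring
        _ < sinh y ^ 2 * cosh y := by gcongr
    have h2 : y ^ 2 * cosh y < sinh y ^ 2 * cosh y := by gcongr
    linarith
  have key := pos_of_hasDerivAt_pos
    (f := fun x => sinh x ^ 2 * cosh x + x * sinh x - 2 * (x ^ 2 * cosh x))
    (fun x => ?_) (by simp) hder_pos hk
  · linarith
  · refine HasDerivAt.congr_deriv ((((hasDerivAt_sinh x).pow 2).mul (hasDerivAt_cosh x)).add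
      ((hasDerivAt_id' x).mul (hasDerivAt_sinh x)) |>.sub
      ((((hasDerivAt_id' x).pow 2).mul (hasDerivAt_cosh x)).const_mul 2)) ?_
    have := cosh_sq x
    simp only [Pi.pow_apply]
    push_cast
    linear_combination (2 * sinh x) * this

theorem self_add_cube_lt_sinh_mul_cosh {k : ℝ} (hk : 0 < k) :
    k + 2 / 3 * k ^ 3 < sinh k * cosh k := by
  have key := pos_of_hasDerivAt_pos
    (f := fun x => sinh x * cosh x - (x + 2 / 3 * x ^ 3))
    (f' := fun x => 2 * (sinh x ^ 2 - x ^ 2))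
    (fun x => ?_) (by simp) (fun x hx => ?_) hk
  · linarith
  · refine HasDerivAt.congr_deriv (((hasDerivAt_sinh x).mul (hasDerivAt_cosh x)).sub
      ((hasDerivAt_id' x).add (((hasDerivAt_id' x).pow 3).const_mul (2 / 3)))) ?_
    have := cosh_sq x
    push_cast
    linear_combination this
  · have hs : x < sinh x := self_lt_sinh_iff.2 hx
    have : x ^ 2 < sinh x ^ 2 := by gcongr
    linarith

/-- The surface tension coefficient for which `k` is a critical point of the phase speed. -/
noncomputable def criticalTension (k : ℝ) : ℝ :=
  (sinh k * cosh k - k) / (k ^ 2 * (sinh k * cosh k + k))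

theorem criticalTension_hasDerivAt {k : ℝ} (hk : 0 < k) :
    HasDerivAt criticalTension
      (-(2 * k * cosh k * (sinh k ^ 2 * cosh k + k * sinh k - 2 * k ^ 2 * cosh k)) /
        (k ^ 2 * (sinh k * cosh k + k)) ^ 2) k := by
  have hs : 0 < sinh k := sinh_pos_iff.2 hk
  have hc : 0 < cosh k := cosh_pos k
  have hp := (hasDerivAt_sinh k).mul (hasDerivAt_cosh k)
  have hid := hasDerivAt_id' k
  refine HasDerivAt.congr_deriv ((hp.sub hid).div ((hid.pow 2).mul (hp.add hid)) (by positivity)) ?_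
  congr 1
  have := cosh_sq k
  simp only [Pi.mul_apply, Pi.sub_apply, Pi.pow_apply]
  push_cast
  linear_combination (-2 * k ^ 3) * this

theorem criticalTension_strictAntiOn : StrictAntiOn criticalTension (Ioi 0) := by
  refine strictAntiOn_of_deriv_neg (convex_Ioi 0)
    (fun k hk => (criticalTension_hasDerivAt hk).continuousAt.continuousWithinAt) fun k hk => ?_
  rw [interior_Ioi] at hk
  have hk : 0 < k := hk
  rw [(criticalTension_hasDerivAt hk).deriv]
  have hs : 0 < sinh k := sinh_pos_iff.2 hk
  have hc : 0 < cosh k := cosh_pos k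
  have h := sub_pos.2 (two_mul_sq_mul_cosh_lt hk)
  apply div_neg_of_neg_of_pos _ (by positivity)
  exact neg_neg_of_pos (by positivity)

theorem inv_three_add_sq_lt_criticalTension {k : ℝ} (hk : 0 < k) :
    1 / (3 + k ^ 2) < criticalTension k := by
  have h := self_add_cube_lt_sinh_mul_cosh hk
  have hs : 0 < sinh k := sinh_pos_iff.2 hk
  have hc : 0 < cosh k := cosh_pos k
  rw [criticalTension, div_lt_div_iff₀ (by positivity) (by positivity)]
  linarith

theorem criticalTension_lt_inv_sq {k : ℝ} (hk : 0 < k) : criticalTension k < 1 / k ^ 2 := by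
  have hs : 0 < sinh k := sinh_pos_iff.2 hk
  have hc : 0 < cosh k := cosh_pos k
  rw [criticalTension, div_lt_div_iff₀ (by positivity) (by positivity)]
  have : 0 < k ^ 2 * k := by positivity
  linarith

theorem exists_criticalTension_eq {T : ℝ} (hT0 : 0 < T) (hT : T < 1 / 3) :
    ∃ k, 0 < k ∧ criticalTension k = T := by
  have hsub : 0 < 1 / T - 3 := by
    have : 3 < 1 / T := by rw [lt_div_iff₀ hT0]; linarith
    linarith
  set a := √(1 / T - 3) with ha
  set b := √(1 / T) with hb
  have ha0 : 0 < a := sqrt_pos.2 hsub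
  have hb0 : 0 < b := sqrt_pos.2 (by positivity)
  have hab : a ≤ b := sqrt_le_sqrt (by linarith)
  have hTa : T ≤ criticalTension a := by
    have h := inv_three_add_sq_lt_criticalTension ha0
    rw [ha, sq_sqrt hsub.le, ← ha, add_sub_cancel, one_div_one_div] at h
    exact h.le
  have hTb : criticalTension b ≤ T := by
    have h := criticalTension_lt_inv_sq hb0
    rw [hb, sq_sqrt (by positivity), ← hb, one_div_one_div] at h
    exact h.le
  obtain ⟨k, hk, hkT⟩ := intermediate_value_Icc' hab
    (fun x hx => (criticalTension_hasDerivAt (ha0.trans_le hx.1)).continuousAt.continuousWithinAt)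
    ⟨hTb, hTa⟩
  exact ⟨k, ha0.trans_le hk.1, hkT⟩

theorem hasDerivAt_sq_phaseSpeed (T : ℝ) {k : ℝ} (hk : 0 < k) :
    HasDerivAt (fun k => (1 + T * k ^ 2) * tanh k / k)
      ((sinh k * cosh k + k) / cosh k ^ 2 * (T - criticalTension k)) k := by
  have hs : 0 < sinh k := sinh_pos_iff.2 hk
  have hc : 0 < cosh k := cosh_pos k
  have hid := hasDerivAt_id' k
  have htanh : HasDerivAt tanh (1 / cosh k ^ 2) k := by
    have h := (hasDerivAt_sinh k).div (hasDerivAt_cosh k) hc.ne'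
    have heq : tanh = sinh / cosh := funext tanh_eq_sinh_div_cosh
    rw [heq]
    refine h.congr_deriv ?_
    congr 1
    linarith [cosh_sq k]
  refine HasDerivAt.congr_deriv (((((hid.pow 2).const_mul T).const_add 1).mul htanh).div hid hk.ne') ?_
  have hne : sinh k * cosh k + k ≠ 0 := by positivity
  simp only [criticalTension, Pi.mul_apply, Pi.pow_apply, tanh_eq_sinh_div_cosh]
  field_simp
  ring

theorem tendsto_sq_phaseSpeed (T : ℝ) :
    Tendsto (fun k => (1 + T * k ^ 2) * tanh k / k) (nhdsWithin 0 (Ioi 0)) (nhds 1) := by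
  have hsinh : Tendsto (fun k : ℝ => sinh k / k) (nhdsWithin 0 (Ioi 0)) (nhds 1) := by
    have h := (hasDerivAt_sinh 0).tendsto_slope_zero_right
    simpa [div_eq_inv_mul] using h
  have hfac : Tendsto (fun k : ℝ => (1 + T * k ^ 2) / cosh k) (nhdsWithin 0 (Ioi 0)) (nhds 1) := by
    have h : ContinuousAt (fun k : ℝ => (1 + T * k ^ 2) / cosh k) 0 :=
      ContinuousAt.div (by fun_prop) continuous_cosh.continuousAt (cosh_pos 0).ne'
    simpa using h.tendsto.mono_left nhdsWithin_le_nhds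
  refine (mul_one (1 : ℝ) ▸ hfac.mul hsinh).congr fun k => ?_
  rw [tanh_eq_sinh_div_cosh]
  ring

/-- For `0 < T < 1/3`, `c_ww(·;T)` possesses a unique minimum over `(0,∞)`: there is a
unique `k* > 0` with `c_ww(k*;T) ≤ c_ww(k;T)` for all `k > 0`, and `c_ww(k*;T) < 1`. -/
theorem cwwT_unique_minimum (T : ℝ) (hT0 : 0 < T) (hT : T < 1 / 3) :
    ∃ kstar : ℝ, 0 < kstar ∧
      (∀ k : ℝ, 0 < k → cwwT T kstar ≤ cwwT T k) ∧
      cwwT T kstar < 1 ∧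
      ∀ k' : ℝ, 0 < k' → (∀ k : ℝ, 0 < k → cwwT T k' ≤ cwwT T k) → k' = kstar := by
  obtain ⟨k₀, hk₀, hcrit⟩ := exists_criticalTension_eq hT0 hT
  set g : ℝ → ℝ := fun k => (1 + T * k ^ 2) * tanh k / k with hg
  have hcont (k : ℝ) (hk : 0 < k) : ContinuousAt g k :=
    (hasDerivAt_sq_phaseSpeed T hk).continuousAt
  have hfac (k : ℝ) (hk : 0 < k) : 0 < (sinh k * cosh k + k) / cosh k ^ 2 := by
    have hs : 0 < sinh k := sinh_pos_iff.2 hk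
    have hc : 0 < cosh k := cosh_pos k
    positivity
  have hanti : StrictAntiOn g (Ioc 0 k₀) := by
    refine strictAntiOn_of_deriv_neg (convex_Ioc 0 k₀)
      (fun k hk => (hcont k hk.1).continuousWithinAt) fun k hk => ?_
    rw [interior_Ioc] at hk
    rw [(hasDerivAt_sq_phaseSpeed T hk.1).deriv]
    have := criticalTension_strictAntiOn hk.1 hk₀ hk.2
    exact mul_neg_of_pos_of_neg (hfac k hk.1) (by linarith)
  have hmono : StrictMonoOn g (Ici k₀) := by
    refine strictMonoOn_of_deriv_pos (convex_Ici k₀)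
      (fun k hk => (hcont k (hk₀.trans_le hk)).continuousWithinAt) fun k hk => ?_
    rw [interior_Ici] at hk
    have hk0 : 0 < k := hk₀.trans hk
    rw [(hasDerivAt_sq_phaseSpeed T hk0).deriv]
    have := criticalTension_strictAntiOn hk₀ hk0 hk
    exact mul_pos (hfac k hk0) (by linarith)
  have hmin (k : ℝ) (hk : 0 < k) (hne : k ≠ k₀) : g k₀ < g k := by
    rcases hne.lt_or_gt with h | h
    · exact hanti ⟨hk, h.le⟩ ⟨hk₀, le_rfl⟩ h
    · exact hmono self_mem_Ici h.le h
  have hlt_one : g k₀ < 1 := by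
    have hhalf : g (k₀ / 2) ≤ 1 := by
      refine ge_of_tendsto (tendsto_sq_phaseSpeed T) ?_
      filter_upwards [Ioo_mem_nhdsGT (half_pos hk₀)] with k hk
      exact (hanti ⟨hk.1, by linarith [hk.2]⟩ ⟨half_pos hk₀, by linarith⟩ hk.2).le
    exact (hmin _ (half_pos hk₀) (by linarith)).trans_le hhalf
  have hspeed (k : ℝ) (hk : 0 < k) : cwwT T k = √(g k) := by simp [cwwT, hk.ne', hg]
  have hpos (k : ℝ) (hk : 0 < k) : 0 < g k := by
    have : 0 < tanh k := by
      rw [tanh_eq_sinh_div_cosh]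
      exact div_pos (sinh_pos_iff.2 hk) (cosh_pos k)
    simp only [hg]
    positivity
  have hmin_speed (k : ℝ) (hk : 0 < k) (hne : k ≠ k₀) : cwwT T k₀ < cwwT T k := by
    rw [hspeed k₀ hk₀, hspeed k hk]
    exact sqrt_lt_sqrt (hpos k₀ hk₀).le (hmin k hk hne)
  refine ⟨k₀, hk₀, fun k hk => ?_, ?_, fun k hk hle => ?_⟩
  · rcases eq_or_ne k k₀ with rfl | hne
    · exact le_rfl
    · exact (hmin_speed k hk hne).le
  · rw [hspeed k₀ hk₀, sqrt_lt' one_pos]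
    simpa using hlt_one
  · by_contra hne
    exact (hmin_speed k hk hne).not_ge (hle k₀ hk₀)
end

section
/- For every k > 0, the second derivative at k of the function k ↦ sqrt(k·tanh k) is negative; equivalently, i₁(k) := (k·c_ww(k;0))'' < 0 for all k > 0, i.e. the derivative of k ↦ sqrt(k·tanh k) (the linear group speed) is strictly decreasing on (0,∞). -/
open Real Filter Set

theorem Real.hasDerivAt_tanh_one_sub_sq (x : ℝ) :
    HasDerivAt Real.tanh (1 - Real.tanh x ^ 2) x := by
  have hc := (Real.cosh_pos x).ne'
  have h := (Real.hasDerivAt_sinh x).div (Real.hasDerivAt_cosh x) hc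
  have he : Real.tanh = Real.sinh / Real.cosh := by
    ext y
    exact Real.tanh_eq_sinh_div_cosh y
  have hv : 1 - Real.tanh x ^ 2 =
      (Real.cosh x * Real.cosh x - Real.sinh x * Real.sinh x) / Real.cosh x ^ 2 := by
    rw [Real.tanh_eq_sinh_div_cosh]
    field_simp
  rw [hv, he]
  exact h

theorem Real.tanh_pos_of_pos {x : ℝ} (hx : 0 < x) : 0 < Real.tanh x := by
  rw [Real.tanh_eq_sinh_div_cosh]
  exact div_pos (Real.sinh_pos_iff.2 hx) (Real.cosh_pos x)

theorem hasDerivAt_mul_tanh (k : ℝ) :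
    HasDerivAt (fun k : ℝ => k * Real.tanh k)
      (Real.tanh k + k * (1 - Real.tanh k ^ 2)) k := by
  have h := (hasDerivAt_id' k).mul (Real.hasDerivAt_tanh_one_sub_sq k)
  rw [one_mul] at h
  exact h

theorem hasDerivAt_sqrt_mul_tanh {k : ℝ} (hk : 0 < k) :
    HasDerivAt (fun k : ℝ => Real.sqrt (k * Real.tanh k))
      ((Real.tanh k + k * (1 - Real.tanh k ^ 2)) / (2 * Real.sqrt (k * Real.tanh k))) k :=
  (hasDerivAt_mul_tanh k).sqrt (ne_of_gt (mul_pos hk (Real.tanh_pos_of_pos hk)))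

/-- The sign of the second derivative reduces to
`(t - k (1 - t²))² + 4 k² t² (1 - t²) > 0` with `t = tanh k`. -/
theorem deriv_deriv_sqrt_mul_tanh_neg {k : ℝ} (hk : 0 < k) :
    deriv (deriv fun k : ℝ => Real.sqrt (k * Real.tanh k)) k < 0 := by
  have heq : (deriv fun k : ℝ => Real.sqrt (k * Real.tanh k)) =ᶠ[nhds k] fun k =>
      (Real.tanh k + k * (1 - Real.tanh k ^ 2)) / (2 * Real.sqrt (k * Real.tanh k)) := by
    filter_upwards [Ioi_mem_nhds hk] with x hx
    exact (hasDerivAt_sqrt_mul_tanh hx).deriv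
  have ht := Real.tanh_pos_of_pos hk
  have hs := sub_pos.2 (Real.tanh_sq_lt_one k)
  have hr : 0 < Real.sqrt (k * Real.tanh k) := Real.sqrt_pos.2 (mul_pos hk ht)
  have hsq : Real.sqrt (k * Real.tanh k) ^ 2 = k * Real.tanh k :=
    Real.sq_sqrt (mul_pos hk ht).le
  have hd := Real.hasDerivAt_tanh_one_sub_sq k
  have hnum := hd.add ((hasDerivAt_id' k).mul ((hd.pow 2).const_sub 1))
  have hquot := hnum.div ((hasDerivAt_sqrt_mul_tanh hk).const_mul 2) (by positivity)
  rw [heq.deriv_eq]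
  refine lt_of_eq_of_lt hquot.deriv ?_
  simp only [Pi.add_apply, Pi.mul_apply, Pi.pow_apply]
  generalize Real.sqrt (k * Real.tanh k) = r at *
  generalize Real.tanh k = t at *
  refine div_neg_of_neg_of_pos ?_ (by positivity)
  have key : 0 < (t - k * (1 - t ^ 2)) ^ 2 + 4 * (k ^ 2 * t ^ 2 * (1 - t ^ 2)) := by
    positivity
  refine lt_of_eq_of_lt ?_ (neg_neg_of_pos (div_pos key hr))
  field_simp
  norm_num
  linear_combination (4 * (1 - t ^ 2) * (1 - k * t)) * hsq

/-- For every `k > 0`, `i₁(k) := (k c_ww(k;0))'' < 0`, where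
`k c_ww(k;0) = sqrt(k tanh k)`; i.e. the linear group speed
`(k c_ww(k;0))'` is strictly decreasing on `(0,∞)`. -/
theorem groupSpeed_strictly_concave :
    (∀ k : ℝ, 0 < k →
        deriv (deriv fun k : ℝ => Real.sqrt (k * Real.tanh k)) k < 0) ∧
      StrictAntiOn (deriv fun k : ℝ => Real.sqrt (k * Real.tanh k))
        (Set.Ioi (0 : ℝ)) := by
  refine ⟨fun k hk => deriv_deriv_sqrt_mul_tanh_neg hk, ?_⟩
  refine strictAntiOn_of_deriv_neg (convex_Ioi 0) (fun k hk => ?_) fun k hk => ?_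
  · exact (differentiableAt_of_deriv_ne_zero
      (deriv_deriv_sqrt_mul_tanh_neg hk).ne).continuousAt.continuousWithinAt
  · rw [interior_Ioi] at hk
    exact deriv_deriv_sqrt_mul_tanh_neg hk
end
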